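/- Let f : [0,1] → ℝ, let K ≥ 2 and N ≥ 1 be integers, let T be the quantized tensor representation of f on D_K, and let ε > 0. Let S_{≤1} := A_L, viewed as a tensor S_{≤1}^β(σ_1) := A_L^{1,β}(σ_1) on {0,1} × {0,…,N}, and for each m = 1,…,K−2 let S_{≤m+1} : {0,1}^{m+1} × {0,…,N} → ℝ be any tensor satisfying ‖S_{≤m+1} − S_{≤m}A‖_F ≤ ε·√(2^{m+1}), where (S_{≤m}A)^β(σ_{1:m+1}) := Σ_{γ=0}^{N} S_{≤m}^γ(σ_{1:m}) A^{γβ}(σ_{m+1}) and ‖·‖_F is the Frobenius norm. Set S(σ_{1:K}) := Σ_{α=0}^{N} S_{≤K−1}^α(σ_{1:K−1}) A_R^{α,1}(σ_K). Then ‖T − S‖_2 ≤ E_{1,N}[f] + (K−2) · Λ_N · ε. -/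

import Mathlib

noncomputable section

/-- The Chebyshev–Lobatto node `c_N^α = (cos(πα/N)+1)/2`, shifted and scaled to `[0,1]`. -/
def chebNode (N α : ℕ) : ℝ := (Real.cos (Real.pi * α / N) + 1) / 2

/-- The Lagrange cardinal polynomial `P_N^α` for the Chebyshev–Lobatto grid. -/
def chebP (N α : ℕ) (x : ℝ) : ℝ :=
  ∏ β ∈ (Finset.range (N + 1)).erase α,
    (x - chebNode N β) / (chebNode N α - chebNode N β)

/-- The real value of a bit. -/
def bitVal (b : Bool) : ℝ := if b then 1 else 0

/-- The quantized tensor representation of `f` on the dyadic grid `D_K`. -/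
def qtt (f : ℝ → ℝ) (K : ℕ) (σ : Fin K → Bool) : ℝ :=
  f (∑ k : Fin K, (2 : ℝ) ^ (-(k.val + 1 : ℤ)) * bitVal (σ k))

/-- The Lebesgue constant `Λ_N = sup_{x ∈ [0,1]} Σ_{α=0}^N |P_N^α(x)|` of `(N+1)`-point
Chebyshev–Lobatto interpolation. -/
def lebesgueConst (N : ℕ) : ℝ :=
  sSup ((fun x => ∑ α ∈ Finset.range (N + 1), |chebP N α x|) '' Set.Icc (0 : ℝ) 1)

open Polynomial in
theorem chebP_eq_eval_basis (N α : ℕ) (x : ℝ) :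
    chebP N α x = (Lagrange.basis (Finset.range (N + 1)) (chebNode N) α).eval x := by
  simp only [chebP, Lagrange.basis, Lagrange.basisDivisor, eval_prod, eval_mul, eval_C, eval_sub,
    eval_X]
  exact Finset.prod_congr rfl fun β _ => by ring

theorem chebNode_injOn (N : ℕ) (hN : 1 ≤ N) :
    Set.InjOn (chebNode N) (Finset.range (N + 1)) := by
  have hN' : (0 : ℝ) < N := by exact_mod_cast hN
  have mem_Icc : ∀ a ∈ Finset.range (N + 1), Real.pi * a / N ∈ Set.Icc 0 Real.pi := by
    intro a ha
    have ha' : (a : ℝ) ≤ N := by exact_mod_cast Finset.mem_range_succ_iff.mp ha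
    refine ⟨by positivity, ?_⟩
    rw [div_le_iff₀ hN']
    exact mul_le_mul_of_nonneg_left ha' Real.pi_pos.le
  intro a ha b hb h
  have h2 : Real.cos (Real.pi * a / N) = Real.cos (Real.pi * b / N) := by
    simp only [chebNode] at h
    linarith
  have h3 := Real.injOn_cos (mem_Icc a ha) (mem_Icc b hb) h2
  have h4 : (a : ℝ) = b := by
    field_simp at h3
    exact h3
  exact_mod_cast h4

open Polynomial in
/-- Polynomials of degree at most `N` are reproduced by interpolation; here for
the rescaled cardinal functions. -/
theorem sum_chebP_mul_chebP (N : ℕ) (hN : 1 ≤ N) (γ : ℕ) (hγ : γ ∈ Finset.range (N + 1))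
    (s x : ℝ) :
    ∑ β : Fin (N + 1), chebP N γ ((s + chebNode N β) / 2) * chebP N β x
      = chebP N γ ((s + x) / 2) := by
  set b := Lagrange.basis (Finset.range (N + 1)) (chebNode N) γ with hb
  set q : ℝ[X] := b.comp (C (1 / 2) * X + C (s / 2)) with hq
  have eval_q : ∀ y, q.eval y = chebP N γ ((s + y) / 2) := by
    intro y
    rw [chebP_eq_eval_basis, hq, eval_comp]
    congr 1
    simp only [eval_add, eval_mul, eval_C, eval_X]
    ring
  have natDegree_b : b.natDegree = N := by
    have := Lagrange.degree_basis (chebNode_injOn N hN) hγ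
    simpa using natDegree_eq_of_degree_eq_some this
  have degree_q : q.degree < (Finset.range (N + 1)).card := by
    rw [Finset.card_range]
    refine lt_of_le_of_lt degree_le_natDegree ?_
    have : q.natDegree ≤ N := by
      refine natDegree_comp_le.trans ?_
      rw [natDegree_b]
      calc _ ≤ N * 1 := Nat.mul_le_mul_left _ natDegree_linear_le
        _ = N := mul_one N
    exact_mod_cast Nat.lt_succ_of_le this
  rw [Fin.sum_univ_eq_sum_range
    (fun β => chebP N γ ((s + chebNode N β) / 2) * chebP N β x) (N + 1), ← eval_q,
    Lagrange.eq_interpolate (chebNode_injOn N hN) degree_q, Lagrange.interpolate_apply,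
    eval_finsetSum]
  refine Finset.sum_congr rfl fun β _ => ?_
  rw [eval_mul, eval_C, eval_q, ← chebP_eq_eval_basis]

theorem sum_abs_chebP_le_lebesgueConst (N : ℕ) {x : ℝ} (hx : x ∈ Set.Icc (0 : ℝ) 1) :
    ∑ α ∈ Finset.range (N + 1), |chebP N α x| ≤ lebesgueConst N := by
  have hc : Continuous fun x => ∑ α ∈ Finset.range (N + 1), |chebP N α x| := by
    unfold chebP
    fun_prop
  exact le_csSup (isCompact_Icc.image hc).bddAbove ⟨x, hx, rfl⟩

theorem lebesgueConst_nonneg (N : ℕ) : 0 ≤ lebesgueConst N :=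
  (Finset.sum_nonneg fun _ _ => abs_nonneg _).trans
    (sum_abs_chebP_le_lebesgueConst N (x := 0) (by simp))

theorem sum_sq_chebP_le (N : ℕ) {x : ℝ} (hx : x ∈ Set.Icc (0 : ℝ) 1) :
    ∑ α : Fin (N + 1), chebP N α x ^ 2 ≤ lebesgueConst N ^ 2 := by
  rw [Fin.sum_univ_eq_sum_range (fun α => chebP N α x ^ 2) (N + 1)]
  simp only [← sq_abs (chebP N _ x)]
  refine (Finset.sum_sq_le_sq_sum_of_nonneg fun _ _ => abs_nonneg _).trans ?_
  exact pow_le_pow_left₀ (Finset.sum_nonneg fun _ _ => abs_nonneg _)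
    (sum_abs_chebP_le_lebesgueConst N hx) 2

/-- The dyadic number with the `n` binary digits `b 0, …, b (n - 1)`. -/
def binFrac : ℕ → (ℕ → Bool) → ℝ
  | 0, _ => 0
  | n + 1, b => (bitVal (b 0) + binFrac n fun k => b (k + 1)) / 2

theorem bitVal_mem_Icc (b : Bool) : bitVal b ∈ Set.Icc (0 : ℝ) 1 := by
  cases b <;> simp [bitVal]

theorem binFrac_mem_Icc (n : ℕ) (b : ℕ → Bool) : binFrac n b ∈ Set.Icc (0 : ℝ) 1 := by
  induction n generalizing b with
  | zero => simp [binFrac]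
  | succ n ih =>
    obtain ⟨h0, h1⟩ := ih fun k => b (k + 1)
    obtain ⟨h2, h3⟩ := bitVal_mem_Icc (b 0)
    rw [binFrac]
    constructor <;> linarith

theorem sum_digits_eq_binFrac (n : ℕ) (b : ℕ → Bool) :
    ∑ k : Fin n, (2 : ℝ) ^ (-(k.val + 1 : ℤ)) * bitVal (b k) = binFrac n b := by
  induction n generalizing b with
  | zero => simp [binFrac]
  | succ n ih =>
    rw [binFrac, ← ih, Fin.sum_univ_succ, add_div, Finset.sum_div]
    congr 1
    · simp
      ring
    · refine Finset.sum_congr rfl fun k _ => ?_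
      have : (-((k.succ : Fin (n + 1)).val + 1 : ℤ)) = -(k.val + 1 : ℤ) - 1 := by
        simp
        ring
      rw [this, zpow_sub₀ two_ne_zero]
      simp
      ring

/-- Extension of a finite bit string by zeros. -/
def padBits {K : ℕ} (σ : Fin K → Bool) (k : ℕ) : Bool :=
  if h : k < K then σ ⟨k, h⟩ else false

theorem padBits_of_lt {K : ℕ} (σ : Fin K → Bool) {k : ℕ} (h : k < K) :
    padBits σ k = σ ⟨k, h⟩ := dif_pos h

/-- The dyadic number formed by the digits of `σ` from position `m` on. -/
def tailFrac {K : ℕ} (m : ℕ) (σ : Fin K → Bool) : ℝ :=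
  binFrac (K - m) fun k => padBits σ (m + k)

theorem tailFrac_mem_Icc {K : ℕ} (m : ℕ) (σ : Fin K → Bool) :
    tailFrac m σ ∈ Set.Icc (0 : ℝ) 1 := binFrac_mem_Icc _ _

theorem tailFrac_eq_half {K m : ℕ} (h : m < K) (σ : Fin K → Bool) :
    tailFrac m σ = (bitVal (padBits σ m) + tailFrac (m + 1) σ) / 2 := by
  unfold tailFrac
  obtain ⟨r, hr⟩ : ∃ r, K - m = r + 1 := ⟨K - m - 1, by omega⟩
  have hr' : K - (m + 1) = r := by omega
  rw [hr, hr', binFrac]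
  simp only [add_zero, add_assoc, add_comm 1]

theorem tailFrac_self {K : ℕ} (σ : Fin K → Bool) : tailFrac K σ = 0 := by
  simp [tailFrac, binFrac]

theorem qtt_eq_tailFrac (f : ℝ → ℝ) (K : ℕ) (σ : Fin K → Bool) :
    qtt f K σ = f (tailFrac 0 σ) := by
  simp only [qtt, tailFrac, ← sum_digits_eq_binFrac]
  congr 1
  refine Finset.sum_congr rfl fun k _ => ?_
  rw [zero_add, padBits_of_lt σ k.isLt]

/-- Summing a function of the first `n` bits over all strings of `K` bits. -/
theorem sum_padBits_prefix {n K : ℕ} (h : n ≤ K) (g : (Fin n → Bool) → ℝ) :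
    ∑ σ : Fin K → Bool, g (fun i => padBits σ i) = 2 ^ (K - n) * ∑ τ, g τ := by
  obtain ⟨r, rfl⟩ := Nat.exists_eq_add_of_le h
  rw [← (Fin.appendEquiv n r).sum_comp, Fintype.sum_prod_type, Finset.mul_sum]
  refine Finset.sum_congr rfl fun τ _ => ?_
  have : ∀ ρ : Fin r → Bool,
      (fun i : Fin n => padBits (Fin.appendEquiv n r (τ, ρ)) i) = τ := by
    intro ρ
    funext i
    rw [padBits_of_lt _ (by omega : (i : ℕ) < n + r)]
    exact Fin.append_left τ ρ i
  simp [this]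

/-- The tensor obtained from `R`, which carries the first `m` bits, by interpolating in the
remaining ones. -/
def interpTail (N K m : ℕ) (R : (Fin m → Bool) → Fin (N + 1) → ℝ) (σ : Fin K → Bool) : ℝ :=
  ∑ γ : Fin (N + 1), R (fun i => padBits σ i) γ * chebP N γ (tailFrac m σ)

/-- One multiplication by the core `A`. -/
def coreMul (N m : ℕ) (R : (Fin m → Bool) → Fin (N + 1) → ℝ) (σ : Fin (m + 1) → Bool)
    (β : Fin (N + 1)) : ℝ :=
  ∑ γ : Fin (N + 1), R (fun i => σ i.castSucc) γ *
    chebP N γ ((bitVal (σ (Fin.last m)) + chebNode N β) / 2)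

theorem interpTail_coreMul (N K m : ℕ) (hN : 1 ≤ N) (hm : m < K)
    (R : (Fin m → Bool) → Fin (N + 1) → ℝ) (σ : Fin K → Bool) :
    interpTail N K (m + 1) (coreMul N m R) σ = interpTail N K m R σ := by
  simp only [interpTail, coreMul, Finset.sum_mul, mul_assoc]
  rw [Finset.sum_comm]
  refine Finset.sum_congr rfl fun γ _ => ?_
  rw [← Finset.mul_sum, sum_chebP_mul_chebP N hN γ (Finset.mem_range.mpr γ.isLt),
    tailFrac_eq_half hm]
  simp

theorem norm_interpTail_le (N K m : ℕ) (hm : m ≤ K)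
    (R : (Fin m → Bool) → Fin (N + 1) → ℝ) (ε : ℝ)
    (hR : √(∑ σ, ∑ β, R σ β ^ 2) ≤ ε * √(2 ^ m)) :
    ‖WithLp.toLp 2 (interpTail N K m R)‖ ≤ √(2 ^ K) * (lebesgueConst N * ε) := by
  rw [EuclideanSpace.norm_eq]
  simp only [Real.norm_eq_abs, sq_abs]
  have hpt : ∀ σ : Fin K → Bool, interpTail N K m R σ ^ 2 ≤
      (∑ β, R (fun i => padBits σ i) β ^ 2) * lebesgueConst N ^ 2 := fun σ =>
    (Finset.sum_mul_sq_le_sq_mul_sq _ _ _).trans <|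
      mul_le_mul_of_nonneg_left (sum_sq_chebP_le N (tailFrac_mem_Icc m σ))
        (Finset.sum_nonneg fun _ _ => sq_nonneg _)
  calc √(∑ σ, interpTail N K m R σ ^ 2)
      ≤ √(2 ^ (K - m) * (∑ τ, ∑ β, R τ β ^ 2) * lebesgueConst N ^ 2) := by
        refine Real.sqrt_le_sqrt ((Finset.sum_le_sum fun σ _ => hpt σ).trans_eq ?_)
        rw [← Finset.sum_mul, sum_padBits_prefix hm fun τ => ∑ β, R τ β ^ 2]
    _ = √(2 ^ (K - m)) * √(∑ τ, ∑ β, R τ β ^ 2) * lebesgueConst N := by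
        rw [Real.sqrt_mul (by positivity), Real.sqrt_mul (by positivity),
          Real.sqrt_sq (lebesgueConst_nonneg N)]
    _ ≤ √(2 ^ (K - m)) * (ε * √(2 ^ m)) * lebesgueConst N := by
        gcongr
        exact lebesgueConst_nonneg N
    _ = √(2 ^ (K - m) * 2 ^ m) * (lebesgueConst N * ε) := by
        rw [Real.sqrt_mul (by positivity)]
        ring
    _ = √(2 ^ K) * (lebesgueConst N * ε) := by
        rw [← pow_add, Nat.sub_add_cancel hm]

theorem norm_toLp_le_of_abs_le {K : ℕ} (F : (Fin K → Bool) → ℝ) {E : ℝ} (hE : ∀ σ, |F σ| ≤ E) :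
    ‖WithLp.toLp 2 F‖ ≤ √(2 ^ K) * E := by
  have hE0 : 0 ≤ E := (abs_nonneg _).trans (hE fun _ => false)
  rw [EuclideanSpace.norm_eq, ← Real.sqrt_sq hE0, ← Real.sqrt_mul (by positivity)]
  refine Real.sqrt_le_sqrt ((Finset.sum_le_sum fun σ _ =>
    pow_le_pow_left₀ (norm_nonneg _) (hE σ) 2).trans_eq ?_)
  simp

/-- rank-revealing construction: given tensors `S_{≤1} = A_L` and
`S_{≤m+1}` with `‖S_{≤m+1} - S_{≤m} A‖_F ≤ ε √(2^{m+1})` for `m = 1,…,K-2`, the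
resulting MPS `S = S_{≤K-1} A_R` satisfies `‖T - S‖_2 ≤ E_{1,N}[f] + (K-2) Λ_N ε`,
where `E1` is an arbitrary upper bound for the interpolation error at level `m = 1`. -/
theorem stmt12 (f : ℝ → ℝ) (K N : ℕ) (hK : 2 ≤ K) (hN : 1 ≤ N) (ε : ℝ) (hε : 0 < ε)
    (Sfam : (m : ℕ) → (Fin m → Bool) → Fin (N + 1) → ℝ)
    (h1 : ∀ σ : Fin 1 → Bool, ∀ β : Fin (N + 1),
      Sfam 1 σ β = f ((bitVal (σ 0) + chebNode N β) / 2))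
    (hstep : ∀ m, 1 ≤ m → m ≤ K - 2 →
      Real.sqrt (∑ σ : (Fin (m + 1) → Bool), ∑ β : Fin (N + 1),
          (Sfam (m + 1) σ β -
            ∑ γ : Fin (N + 1), Sfam m (fun i => σ i.castSucc) γ *
              chebP N γ ((bitVal (σ (Fin.last m)) + chebNode N β) / 2)) ^ 2)
        ≤ ε * Real.sqrt ((2 : ℝ) ^ (m + 1)))
    (E1 : ℝ)
    (hE : ∀ u ∈ Set.Icc (0 : ℝ) (1 - (2 : ℝ) ^ (-(1 : ℤ))), ∀ v ∈ Set.Icc (0 : ℝ) 1,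
      |f (u + (2 : ℝ) ^ (-(1 : ℤ)) * v) -
        ∑ α ∈ Finset.range (N + 1),
          f (u + (2 : ℝ) ^ (-(1 : ℤ)) * chebNode N α) * chebP N α v| ≤ E1) :
    Real.sqrt ((2 : ℝ) ^ (-(K : ℤ)) * ∑ σ : (Fin K → Bool),
        (qtt f K σ -
          ∑ α : Fin (N + 1),
            Sfam (K - 1) (fun i => σ (Fin.castLE (Nat.sub_le K 1) i)) α *
              chebP N α (bitVal (σ ⟨K - 1, by omega⟩) / 2)) ^ 2)
      ≤ E1 + ((K : ℝ) - 2) * lebesgueConst N * ε := by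
  have hbase : ∀ σ : Fin K → Bool, |qtt f K σ - interpTail N K 1 (Sfam 1) σ| ≤ E1 := by
    intro σ
    have hu : bitVal (padBits σ 0) / 2 ∈ Set.Icc (0 : ℝ) (1 - (2 : ℝ) ^ (-(1 : ℤ))) := by
      obtain ⟨h0, h1⟩ := bitVal_mem_Icc (padBits σ 0)
      norm_num
      constructor <;> linarith
    have half_add : ∀ x : ℝ, bitVal (padBits σ 0) / 2 + (2 : ℝ) ^ (-(1 : ℤ)) * x =
        (bitVal (padBits σ 0) + x) / 2 := fun x => by
      rw [zpow_neg_one]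
      ring
    have h := hE _ hu _ (tailFrac_mem_Icc 1 σ)
    simp only [half_add] at h
    rw [qtt_eq_tailFrac, tailFrac_eq_half (by omega)]
    simp only [interpTail, h1]
    rw [Finset.sum_range] at h
    exact h
  have hind : ∀ m : ℕ, m + 1 ≤ K - 1 →
      ‖WithLp.toLp 2 (fun σ => qtt f K σ - interpTail N K (m + 1) (Sfam (m + 1)) σ)‖ ≤
        √(2 ^ K) * (E1 + m * (lebesgueConst N * ε)) := by
    intro m
    induction m with
    | zero =>
      intro _
      simpa using norm_toLp_le_of_abs_le _ hbase
    | succ m ih =>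
      intro hm
      have hnorm := norm_interpTail_le N K (m + 2) (by omega)
        (fun σ β => Sfam (m + 2) σ β - coreMul N (m + 1) (Sfam (m + 1)) σ β) ε
        (hstep (m + 1) (by omega) (by omega))
      have hsplit : (fun σ => qtt f K σ - interpTail N K (m + 2) (Sfam (m + 2)) σ) =
          (fun σ => qtt f K σ - interpTail N K (m + 1) (Sfam (m + 1)) σ) -
          interpTail N K (m + 2)
            (fun σ β => Sfam (m + 2) σ β - coreMul N (m + 1) (Sfam (m + 1)) σ β) := by
        funext σ
        rw [Pi.sub_apply, ← interpTail_coreMul N K (m + 1) hN (by omega)]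
        simp only [interpTail, sub_mul, Finset.sum_sub_distrib]
        ring
      rw [hsplit, WithLp.toLp_sub]
      refine (norm_sub_le _ _).trans ((add_le_add (ih (by omega)) hnorm).trans_eq ?_)
      push_cast
      ring
  have hlast : ∀ σ : Fin K → Bool, interpTail N K (K - 1) (Sfam (K - 1)) σ =
      ∑ α : Fin (N + 1), Sfam (K - 1) (fun i => σ (Fin.castLE (Nat.sub_le K 1) i)) α *
        chebP N α (bitVal (σ ⟨K - 1, by omega⟩) / 2) := by
    intro σ
    have hbits : (fun i : Fin (K - 1) => padBits σ i) =
        fun i => σ (Fin.castLE (Nat.sub_le K 1) i) := by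
      funext i
      exact padBits_of_lt σ (by omega)
    have hK1 : K - 1 + 1 = K := by omega
    rw [interpTail, hbits, tailFrac_eq_half (by omega : K - 1 < K), hK1, tailFrac_self, add_zero,
      padBits_of_lt σ (by omega : K - 1 < K)]
  have hfin := hind (K - 2) (by omega)
  rw [show K - 2 + 1 = K - 1 by omega, EuclideanSpace.norm_eq, Nat.cast_sub hK] at hfin
  simp only [Real.norm_eq_abs, sq_abs, hlast] at hfin
  rw [Real.sqrt_mul (by positivity), zpow_neg, zpow_natCast, Real.sqrt_inv,
    inv_mul_le_iff₀ (by positivity)]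
  refine hfin.trans_eq ?_
  push_cast
  ring
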